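/- arXiv:1203.0367 — 7 statements merged into one kernel-verified Lean document; each statement's English description precedes it below -/
import Mathlib

section
/- Let g be a Lie 2-algebra over a field k and let (X,l_X), (Y,l_Y) ∈ Der⁰(g). Set [X,Y]_C = (X₀Y₀ − Y₀X₀, X₁Y₁ − Y₁X₁) and l_{[X,Y]_C}(x,y) = l_X(Yx,y) + l_X(x,Yy) − l_Y(Xx,y) − l_Y(x,Xy) + X l_Y(x,y) − Y l_X(x,y). Then ([X,Y]_C, l_{[X,Y]_C}) ∈ Der⁰(g), i.e. the pair satisfies conditions (a), (b) and (c) of a degree-0 derivation. -/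
/-- A Lie 2-algebra: a 2-term complex `d : g1 → g0` with a skew-symmetric bracket
(`br0` on degree 0, `br1` mixing degrees, with `[a,x] := -[x,a]`) and an alternating
Jacobiator `l3`, satisfying the Lie 2-algebra axioms. -/
structure LieTwo (k : Type*) (g0 : Type*) (g1 : Type*) [Field k]
    [AddCommGroup g0] [Module k g0] [AddCommGroup g1] [Module k g1] where
  d : g1 →ₗ[k] g0
  br0 : g0 →ₗ[k] g0 →ₗ[k] g0
  br1 : g0 →ₗ[k] g1 →ₗ[k] g1
  l3 : g0 →ₗ[k] g0 →ₗ[k] g0 →ₗ[k] g1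
  br0_skew : ∀ x y, br0 x y = - br0 y x
  l3_skew12 : ∀ x y z, l3 x y z = - l3 y x z
  l3_skew23 : ∀ x y z, l3 x y z = - l3 x z y
  d_br1 : ∀ x a, d (br1 x a) = br0 x (d a)
  br1_dd : ∀ a b, br1 (d a) b = - br1 (d b) a
  jac0 : ∀ x y z, br0 x (br0 y z) + br0 y (br0 z x) + br0 z (br0 x y) = d (l3 x y z)
  jac1 : ∀ x y a, br1 x (br1 y a) - br1 y (br1 x a) - br1 (br0 x y) a = l3 x y (d a)
  jacobiator : ∀ x y z t,
    l3 (br0 x y) z t + l3 (br0 y z) t x + l3 (br0 z t) x y + l3 (br0 t x) y z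
      = - br1 t (l3 x y z) - br1 x (l3 y z t) - br1 y (l3 z t x) - br1 z (l3 t x y)

namespace LieTwo

variable {k g0 g1 : Type*} [Field k] [AddCommGroup g0] [Module k g0]
  [AddCommGroup g1] [Module k g1]

/-- A derivation of degree 0 of a Lie 2-algebra: a pair `(X, l_X)` with
`X = (X0, X1)`, `X0 ∘ d = d ∘ X1`, `l_X` skew-symmetric, satisfying (a), (b), (c). -/
structure Der0 (T : LieTwo k g0 g1) where
  X0 : g0 →ₗ[k] g0
  X1 : g1 →ₗ[k] g1
  lX : g0 →ₗ[k] g0 →ₗ[k] g1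
  compat : ∀ a, X0 (T.d a) = T.d (X1 a)
  lX_skew : ∀ x y, lX x y = - lX y x
  conda : ∀ x y, X0 (T.br0 x y) - T.br0 (X0 x) y - T.br0 x (X0 y) = T.d (lX x y)
  condb : ∀ x a, X1 (T.br1 x a) - T.br1 (X0 x) a - T.br1 x (X1 a) = lX x (T.d a)
  condc : ∀ x y z,
    lX x (T.br0 y z) + T.br1 x (lX y z) + T.l3 (X0 x) y z + T.l3 x (X0 y) z
        + T.l3 x y (X0 z)
      = X1 (T.l3 x y z) + lX (T.br0 x y) z + lX y (T.br0 x z)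
        - T.br1 z (lX x y) + T.br1 y (lX x z)

/-- The `l`-component `l_{[X,Y]_C}` of the bracket of two derivation triples
`(X0,X1,lX)` and `(Y0,Y1,lY)`. -/
def lBc (X0 : g0 →ₗ[k] g0) (X1 : g1 →ₗ[k] g1) (lX : g0 →ₗ[k] g0 →ₗ[k] g1)
    (Y0 : g0 →ₗ[k] g0) (Y1 : g1 →ₗ[k] g1) (lY : g0 →ₗ[k] g0 →ₗ[k] g1) :
    g0 →ₗ[k] g0 →ₗ[k] g1 :=
  lX ∘ₗ Y0 + lX.compl₂ Y0 - lY ∘ₗ X0 - lY.compl₂ X0 + lY.compr₂ X1 - lX.compr₂ Y1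

/-- `l_{[X,Y]_C}` for two derivations. -/
def lB {T : LieTwo k g0 g1} (X Y : T.Der0) : g0 →ₗ[k] g0 →ₗ[k] g1 :=
  lBc X.X0 X.X1 X.lX Y.X0 Y.X1 Y.lX

/-- Degree-0 component of the commutator `[X,Y]_C` of two derivations. -/
def cc0 {T : LieTwo k g0 g1} (X Y : T.Der0) : g0 →ₗ[k] g0 :=
  X.X0 ∘ₗ Y.X0 - Y.X0 ∘ₗ X.X0

/-- Degree-1 component of the commutator `[X,Y]_C` of two derivations. -/
def cc1 {T : LieTwo k g0 g1} (X Y : T.Der0) : g1 →ₗ[k] g1 :=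
  X.X1 ∘ₗ Y.X1 - Y.X1 ∘ₗ X.X1

variable (T : LieTwo k g0 g1)

/-- `l_{δ(D)}(x,y) = D[x,y] - [x, D y] + [y, D x]` (where `[Dx,y] = -[y,Dx]`). -/
def lδ (D : g0 →ₗ[k] g1) : g0 →ₗ[k] g0 →ₗ[k] g1 :=
  T.br0.compr₂ D - T.br1.compl₂ D + (T.br1.compl₂ D).flip

/-- `ad_a : g0 → g1`, `ad_a u = [a,u] = -[u,a]` for `a` of degree 1. -/
def adg1 (a : g1) : g0 →ₗ[k] g1 := - (T.br1.flip a)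

/-- Degree-0 `End`-component of `d_D(D,x) = δ(D) + ad_x`. -/
def dd0 (D : g0 →ₗ[k] g1) (x : g0) : g0 →ₗ[k] g0 := T.d ∘ₗ D + T.br0 x

/-- Degree-1 `End`-component of `d_D(D,x) = δ(D) + ad_x`. -/
def dd1 (D : g0 →ₗ[k] g1) (x : g0) : g1 →ₗ[k] g1 := D ∘ₗ T.d + T.br1 x

/-- `l`-component of `d_D(D,x) = (δ(D) + ad_x, l_{δ(D)} + l3(x,·,·))`. -/
def ddl (D : g0 →ₗ[k] g1) (x : g0) : g0 →ₗ[k] g0 →ₗ[k] g1 := T.lδ D + T.l3 x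

/-- `⟦(D,x),(D',x')⟧ = -D x' - D' x`. -/
def brDD (D : g0 →ₗ[k] g1) (x : g0) (D' : g0 →ₗ[k] g1) (x' : g0) : g1 :=
  - D x' - D' x

/-- Hom-component of `⟦X,(D,x)⟧ = ([X,D]_C + l_X(x,·), X0 x)` for a derivation
triple `(X0,X1,lX)`. -/
def brXD1c (X0 : g0 →ₗ[k] g0) (X1 : g1 →ₗ[k] g1) (lX : g0 →ₗ[k] g0 →ₗ[k] g1)
    (D : g0 →ₗ[k] g1) (x : g0) : g0 →ₗ[k] g1 :=
  X1 ∘ₗ D - D ∘ₗ X0 + lX x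

/-- `⟦X,(D,x)⟧` as a pair in `Hom(g0,g1) × g0`. -/
def brXDc (X0 : g0 →ₗ[k] g0) (X1 : g1 →ₗ[k] g1) (lX : g0 →ₗ[k] g0 →ₗ[k] g1)
    (D : g0 →ₗ[k] g1) (x : g0) : (g0 →ₗ[k] g1) × g0 :=
  (brXD1c X0 X1 lX D x, X0 x)

end LieTwo

open LieTwo

namespace LieTwo

section Commutator

variable {k g0 g1 : Type*} [Field k] [AddCommGroup g0] [Module k g0]
  [AddCommGroup g1] [Module k g1] {T : LieTwo k g0 g1}

theorem lB_apply (X Y : T.Der0) (x y : g0) :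
    lB X Y x y = X.lX (Y.X0 x) y + X.lX x (Y.X0 y) - Y.lX (X.X0 x) y - Y.lX x (X.X0 y)
      + X.X1 (Y.lX x y) - Y.X1 (X.lX x y) := rfl

theorem cc0_apply (X Y : T.Der0) (x : g0) :
    cc0 X Y x = X.X0 (Y.X0 x) - Y.X0 (X.X0 x) := rfl

theorem cc1_apply (X Y : T.Der0) (a : g1) :
    cc1 X Y a = X.X1 (Y.X1 a) - Y.X1 (X.X1 a) := rfl

namespace Der0

theorem X0_br0 (X : T.Der0) (x y : g0) :
    X.X0 (T.br0 x y) = T.br0 (X.X0 x) y + T.br0 x (X.X0 y) + T.d (X.lX x y) := by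
  rw [← X.conda]; abel

theorem X1_br1 (X : T.Der0) (x : g0) (a : g1) :
    X.X1 (T.br1 x a) = T.br1 (X.X0 x) a + T.br1 x (X.X1 a) + X.lX x (T.d a) := by
  rw [← X.condb]; abel

theorem X1_l3 (X : T.Der0) (x y z : g0) :
    X.X1 (T.l3 x y z) =
      X.lX x (T.br0 y z) + T.br1 x (X.lX y z) + T.l3 (X.X0 x) y z
        + T.l3 x (X.X0 y) z + T.l3 x y (X.X0 z) - X.lX (T.br0 x y) z
        - X.lX y (T.br0 x z) + T.br1 z (X.lX x y) - T.br1 y (X.lX x z) := by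
  rw [X.condc]; abel

/-- The commutator of two degree-0 derivations. -/
def commutator (X Y : T.Der0) : T.Der0 where
  X0 := cc0 X Y
  X1 := cc1 X Y
  lX := lB X Y
  compat a := by
    simp only [cc0_apply, cc1_apply, compat, map_sub]
  lX_skew x y := by
    rw [lB_apply, lB_apply, X.lX_skew (Y.X0 x), X.lX_skew x, Y.lX_skew (X.X0 x),
      Y.lX_skew x, X.lX_skew x y, Y.lX_skew x y, map_neg, map_neg]
    abel
  conda x y := by
    simp only [cc0_apply, lB_apply, X0_br0, compat, map_add, map_sub, LinearMap.sub_apply]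
    abel
  condb x a := by
    simp only [cc0_apply, cc1_apply, lB_apply, X1_br1, compat, map_add, map_sub,
      LinearMap.sub_apply]
    abel
  condc x y z := by
    have hX (b : g1) (w : g0) : X.lX (T.d b) w = - X.lX w (T.d b) := X.lX_skew _ _
    have hY (b : g1) (w : g0) : Y.lX (T.d b) w = - Y.lX w (T.d b) := Y.lX_skew _ _
    simp only [cc0_apply, cc1_apply, lB_apply, X1_l3, X0_br0, X1_br1, hX, hY,
      map_add, map_sub, LinearMap.sub_apply, LinearMap.add_apply]
    abel

end Der0

end Commutator

end LieTwo

/-- The commutator bracket `([X,Y]_C, l_{[X,Y]_C})` of two degree-0 derivations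
is again a degree-0 derivation. -/
theorem stmt2 {k g0 g1 : Type*} [Field k] [AddCommGroup g0] [Module k g0]
    [AddCommGroup g1] [Module k g1] (T : LieTwo k g0 g1) (X Y : T.Der0) :
    ∃ Z : T.Der0, Z.X0 = X.X0 ∘ₗ Y.X0 - Y.X0 ∘ₗ X.X0 ∧
      Z.X1 = X.X1 ∘ₗ Y.X1 - Y.X1 ∘ₗ X.X1 ∧
      ∀ x y, Z.lX x y
        = X.lX (Y.X0 x) y + X.lX x (Y.X0 y) - Y.lX (X.X0 x) y - Y.lX x (X.X0 y)
          + X.X1 (Y.lX x y) - Y.X1 (X.lX x y) := by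
  exact ⟨X.commutator Y, rfl, rfl, fun _ _ => rfl⟩
end

section
/- Let g be a Lie 2-algebra over a field k. For any linear map D: g₀ → g₁, the pair δ̄(D) = (δ(D), l_{δ(D)}), where δ(D) = (d∘D, D∘d) and l_{δ(D)}(x,y) = D[x,y] − [x, D(y)] − [D(x), y], is a derivation of degree 0 of g, i.e. δ̄(D) ∈ Der⁰(g). -/
open LieTwo

namespace LieTwo

variable {k g0 g1 : Type*} [Field k] [AddCommGroup g0] [Module k g0]
  [AddCommGroup g1] [Module k g1] (T : LieTwo k g0 g1)

theorem lδ_apply (D : g0 →ₗ[k] g1) (x y : g0) :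
    T.lδ D x y = D (T.br0 x y) - T.br1 x (D y) + T.br1 y (D x) := by
  simp [lδ]

theorem l3_cyclic (x y z : g0) : T.l3 x y z = T.l3 y z x := by
  rw [T.l3_skew12 x y z, T.l3_skew23 y x z, neg_neg]

/-- The Jacobi identity up to `d ∘ l3`, in Leibniz form. -/
theorem br0_leibniz (x y z : g0) :
    T.br0 x (T.br0 y z) =
      T.d (T.l3 x y z) + T.br0 (T.br0 x y) z + T.br0 y (T.br0 x z) := by
  rw [← T.jac0 x y z, T.br0_skew (T.br0 x y) z, T.br0_skew z x, map_neg]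
  abel

/-- The derivation `δ̄(D) = ((d ∘ D, D ∘ d), l_{δ(D)})` attached to `D : g0 → g1`. -/
def derOfHom (D : g0 →ₗ[k] g1) : T.Der0 where
  X0 := T.d ∘ₗ D
  X1 := D ∘ₗ T.d
  lX := T.lδ D
  compat _ := rfl
  lX_skew x y := by
    rw [lδ_apply, lδ_apply, T.br0_skew x y, map_neg]
    abel
  conda x y := by
    simp only [LinearMap.comp_apply, lδ_apply, map_add, map_sub, T.d_br1]
    rw [T.br0_skew (T.d (D x)) y]
    abel
  condb x a := by
    simp only [LinearMap.comp_apply, lδ_apply, T.d_br1]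
    rw [T.br1_dd (D x) a]
    abel
  condc x y z := by
    simp only [LinearMap.comp_apply, lδ_apply, map_add, map_sub]
    rw [T.br0_leibniz x y z, T.l3_cyclic (T.d (D x)) y z, T.l3_skew23 x (T.d (D y)) z,
      ← T.jac1 y z (D x), ← T.jac1 x z (D y), ← T.jac1 x y (D z), map_add, map_add]
    abel

end LieTwo

/-- For any linear map `D : g0 → g1`, `δ̄(D) = ((d∘D, D∘d), l_{δ(D)})` is a
degree-0 derivation of `g`. -/
theorem stmt4 {k g0 g1 : Type*} [Field k] [AddCommGroup g0] [Module k g0]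
    [AddCommGroup g1] [Module k g1] (T : LieTwo k g0 g1) (D : g0 →ₗ[k] g1) :
    ∃ Z : T.Der0, Z.X0 = T.d ∘ₗ D ∧ Z.X1 = D ∘ₗ T.d ∧ Z.lX = T.lδ D := by
  exact ⟨T.derOfHom D, rfl, rfl, rfl⟩
end

section
/- Let g be a Lie 2-algebra over a field k, (X,l_X) ∈ Der⁰(g), and D: g₀ → g₁ a linear map. Then δ̄([X,D]_C) = [(X,l_X), δ̄(D)]_Der, where [X,D]_C = X₁∘D − D∘X₀; explicitly, δ([X,D]_C) = [X, δ(D)]_C and l_{δ([X,D]_C)}(x,y) = l_X(d D(x), y) + l_X(x, d D(y)) − l_{δ(D)}(X x, y) − l_{δ(D)}(x, X y) + X l_{δ(D)}(x,y) − D(d l_X(x,y)) for all x,y ∈ g₀. -/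
open LieTwo

/-- `δ̄([X,D]_C) = [(X,l_X), δ̄(D)]_Der`, componentwise. -/
theorem stmt5 {k g0 g1 : Type*} [Field k] [AddCommGroup g0] [Module k g0]
    [AddCommGroup g1] [Module k g1] (T : LieTwo k g0 g1)
    (X : T.Der0) (D : g0 →ₗ[k] g1) :
    -- δ([X,D]_C) = [X, δ(D)]_C
    T.d ∘ₗ (X.X1 ∘ₗ D - D ∘ₗ X.X0) = X.X0 ∘ₗ (T.d ∘ₗ D) - (T.d ∘ₗ D) ∘ₗ X.X0 ∧
    (X.X1 ∘ₗ D - D ∘ₗ X.X0) ∘ₗ T.d = X.X1 ∘ₗ (D ∘ₗ T.d) - (D ∘ₗ T.d) ∘ₗ X.X1 ∧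
    -- l_{δ([X,D]_C)} = l_{[X,δ(D)]_C}
    (∀ x y, T.lδ (X.X1 ∘ₗ D - D ∘ₗ X.X0) x y
      = X.lX (T.d (D x)) y + X.lX x (T.d (D y))
        - T.lδ D (X.X0 x) y - T.lδ D x (X.X0 y)
        + X.X1 (T.lδ D x y) - D (T.d (X.lX x y))) := by
  refine ⟨?_, ?_, fun x y => ?_⟩
  · ext x
    simp [X.compat]
  · ext a
    simp [X.compat]
  · rw [X.lX_skew (T.d (D x)) y, ← X.condb, ← X.condb, ← X.conda]
    simp only [lδ, LinearMap.add_apply, LinearMap.sub_apply, LinearMap.compr₂_apply,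
      LinearMap.compl₂_apply, LinearMap.flip_apply, LinearMap.comp_apply, map_add, map_sub]
    abel
end

section
/- Let g be a Lie 2-algebra over a field k. The differential d_D of the 3-term complex DER(g) satisfies d_D ∘ d_D = 0; explicitly, for every a ∈ g₁ one has δ(ad_a) = ad_{d a} (i.e. d∘ad_a = ad_{da} on g₀ and ad_a∘d = ad_{da} on g₁, where ad_a(u) = [a,u] := −[u,a]) and l_{δ(ad_a)}(x,y) = l₃(d a, x, y) for all x,y ∈ g₀, so that δ̄(ad_a) = (ad_{d a}, l₃(d a, ·, ·)) and hence d_D(d_D(a)) = 0. -/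
open LieTwo

/-- `d_D ∘ d_D = 0` on the derivation complex `DER(g)`: for `a ∈ g1`,
`δ(ad_a) = ad_{d a}`, `l_{δ(ad_a)} = l3(d a, ·, ·)`, hence `d_D (d_D a) = 0`. -/
theorem stmt8 {k g0 g1 : Type*} [Field k] [AddCommGroup g0] [Module k g0]
    [AddCommGroup g1] [Module k g1] (T : LieTwo k g0 g1) (a : g1) :
    -- d ∘ ad_a = ad_{da} on g0
    (∀ u, T.d (T.adg1 a u) = T.br0 (T.d a) u) ∧
    -- ad_a ∘ d = ad_{da} on g1
    (∀ m, T.adg1 a (T.d m) = T.br1 (T.d a) m) ∧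
    -- l_{δ(ad_a)} = l3(da, ·, ·)
    (∀ x y, T.lδ (T.adg1 a) x y = T.l3 (T.d a) x y) ∧
    -- hence d_D (d_D a) = d_D (ad_a, −d a) = 0
    T.dd0 (T.adg1 a) (- T.d a) = 0 ∧
    T.dd1 (T.adg1 a) (- T.d a) = 0 ∧
    T.ddl (T.adg1 a) (- T.d a) = 0 := by
  have h0 : ∀ u, T.d (T.adg1 a u) = T.br0 (T.d a) u := fun u => by
    simp [adg1, T.d_br1, T.br0_skew (T.d a) u]
  have h1 : ∀ m, T.adg1 a (T.d m) = T.br1 (T.d a) m := fun m => by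
    simp [adg1, T.br1_dd a m]
  have hl : ∀ x y, T.lδ (T.adg1 a) x y = T.l3 (T.d a) x y := fun x y => by
    rw [T.l3_skew12, T.l3_skew23, neg_neg, ← T.jac1]
    simp only [lδ, adg1, LinearMap.add_apply, LinearMap.sub_apply, LinearMap.neg_apply,
      LinearMap.compr₂_apply, LinearMap.compl₂_apply, LinearMap.flip_apply, map_neg]
    abel
  refine ⟨h0, h1, hl, ?_, ?_, ?_⟩
  · ext u
    simp [dd0, h0]
  · ext m
    simp [dd1, h1]
  · ext x y
    simp [ddl, hl]
end

section
/- Let g be a Lie 2-algebra over a field k. For all D, D' ∈ Hom(g₀,g₁) and x, x' ∈ g₀, one has d_D⟦(D,x),(D',x')⟧ = ⟦d_D(D,x),(D',x')⟧ − ⟦(D,x), d_D(D',x')⟧; explicitly, (ad_{−D(x')−D'(x)}, −d(−D(x')−D'(x)))... i.e. (−ad_{D(x')} − ad_{D'(x)}, d(D(x')) + d(D'(x))) = ⟦(δ(D)+ad_x, l_{δ(D)}+l₃(x,·,·)),(D',x')⟧ − ⟦(D,x),(δ(D')+ad_{x'}, l_{δ(D')}+l₃(x',·,·))⟧. -/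
open LieTwo

/-- `d_D ⟦(D,x),(D',x')⟧ = ⟦d_D(D,x),(D',x')⟧ − ⟦(D,x), d_D(D',x')⟧`,
componentwise in `Hom(g0,g1) ⊕ g0`. -/
theorem stmt10 {k g0 g1 : Type*} [Field k] [AddCommGroup g0] [Module k g0]
    [AddCommGroup g1] [Module k g1] (T : LieTwo k g0 g1)
    (D D' : g0 →ₗ[k] g1) (x x' : g0) :
    -- Hom-component
    T.adg1 (brDD D x D' x')
      = brXD1c (T.dd0 D x) (T.dd1 D x) (T.ddl D x) D' x'
        + brXD1c (T.dd0 D' x') (T.dd1 D' x') (T.ddl D' x') D x ∧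
    -- g0-component
    - T.d (brDD D x D' x') = T.dd0 D x x' + T.dd0 D' x' x := by
  constructor
  · ext u
    have h := T.l3_skew12 x x' u
    simp only [adg1, brDD, brXD1c, dd0, dd1, ddl, lδ, LinearMap.add_apply, LinearMap.sub_apply,
      LinearMap.neg_apply, LinearMap.comp_apply, LinearMap.flip_apply, LinearMap.compr₂_apply,
      LinearMap.compl₂_apply, map_add, map_sub, map_neg, h]
    abel
  · have h := T.br0_skew x x'
    simp only [brDD, dd0, LinearMap.add_apply, LinearMap.comp_apply, map_sub, map_neg, h]
    abel
end

section
/- Let g be a Lie 2-algebra over a field k. For all (X,l_X), (Y,l_Y) ∈ Der⁰(g), D ∈ Hom(g₀,g₁) and x ∈ g₀, the bracket ⟦·,·⟧ of DER(g) satisfies the Jacobi identity ⟦⟦(X,l_X),(Y,l_Y)⟧,(D,x)⟧ + ⟦⟦(Y,l_Y),(D,x)⟧,(X,l_X)⟧ + ⟦⟦(D,x),(X,l_X)⟧,(Y,l_Y)⟧ = 0 in Hom(g₀,g₁) ⊕ g₀. -/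
open LieTwo

/-- Jacobi identity of `⟦·,·⟧` in the case (Der⁰, Der⁰, degree-1):
`⟦⟦X,Y⟧,(D,x)⟧ + ⟦⟦Y,(D,x)⟧,X⟧ + ⟦⟦(D,x),X⟧,Y⟧ = 0` in `Hom(g0,g1) ⊕ g0`. -/
theorem stmt11 {k g0 g1 : Type*} [Field k] [AddCommGroup g0] [Module k g0]
    [AddCommGroup g1] [Module k g1] (T : LieTwo k g0 g1)
    (X Y : T.Der0) (D : g0 →ₗ[k] g1) (x : g0) :
    brXDc (cc0 X Y) (cc1 X Y) (lB X Y) D x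
      - brXDc X.X0 X.X1 X.lX (brXD1c Y.X0 Y.X1 Y.lX D x) (Y.X0 x)
      + brXDc Y.X0 Y.X1 Y.lX (brXD1c X.X0 X.X1 X.lX D x) (X.X0 x) = 0 := by
  ext y
  · simp [brXDc, brXD1c, cc0, cc1, lB, lBc]
    abel
  · simp [brXDc, cc0]
end

section
/- Let g be a Lie 2-algebra over a field k. For all (X,l_X) ∈ Der⁰(g), D, D' ∈ Hom(g₀,g₁) and x, x' ∈ g₀, the bracket ⟦·,·⟧ of DER(g) satisfies ⟦⟦(X,l_X),(D,x)⟧,(D',x')⟧ + ⟦⟦(D,x),(D',x')⟧,(X,l_X)⟧ − ⟦⟦(D',x'),(X,l_X)⟧,(D,x)⟧ = 0 in g₁. -/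
open LieTwo

/-- Jacobi identity of `⟦·,·⟧` in the case (Der⁰, degree-1, degree-1):
`⟦⟦X,(D,x)⟧,(D',x')⟧ + ⟦⟦(D,x),(D',x')⟧,X⟧ − ⟦⟦(D',x'),X⟧,(D,x)⟧ = 0` in `g1`. -/
theorem stmt12 {k g0 g1 : Type*} [Field k] [AddCommGroup g0] [Module k g0]
    [AddCommGroup g1] [Module k g1] (T : LieTwo k g0 g1)
    (X : T.Der0) (D D' : g0 →ₗ[k] g1) (x x' : g0) :
    brDD (brXD1c X.X0 X.X1 X.lX D x) (X.X0 x) D' x'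
      + (- X.X1 (brDD D x D' x'))
      - brDD (- brXD1c X.X0 X.X1 X.lX D' x') (- X.X0 x') D x = 0 := by
  simp only [brDD, brXD1c, LinearMap.add_apply, LinearMap.sub_apply, LinearMap.neg_apply,
    LinearMap.comp_apply, map_neg, map_sub, X.lX_skew x' x]
  abel
end
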